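/- arXiv:2404.18641 — 2 statements merged into one kernel-verified Lean document; each statement's English description precedes it below -/
import Mathlib

section
/- H(gl(1,1)) is not a prime ring. -/
open FreeAlgebra

noncomputable section

/-- The defining relations of the bosonization `H(gl(1,1))`: generators
`x = ι 0`, `y = ι 1`, `u = ι 2`, `v = ι 3`, `t = ι 4`. -/
inductive Hrel : FreeAlgebra ℂ (Fin 5) → FreeAlgebra ℂ (Fin 5) → Prop
  | xy : Hrel (ι ℂ 0 * ι ℂ 1) (ι ℂ 1 * ι ℂ 0)
  | xu : Hrel (ι ℂ 0 * ι ℂ 2) (ι ℂ 2 * ι ℂ 0)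
  | xv : Hrel (ι ℂ 0 * ι ℂ 3) (ι ℂ 3 * ι ℂ 0)
  | yu : Hrel (ι ℂ 1 * ι ℂ 2 - ι ℂ 2 * ι ℂ 1) (ι ℂ 2)
  | yv : Hrel (ι ℂ 1 * ι ℂ 3 - ι ℂ 3 * ι ℂ 1) (-ι ℂ 3)
  | uu : Hrel (ι ℂ 2 * ι ℂ 2) 0
  | vv : Hrel (ι ℂ 3 * ι ℂ 3) 0
  | uv : Hrel (ι ℂ 2 * ι ℂ 3 + ι ℂ 3 * ι ℂ 2) (ι ℂ 0)
  | tt : Hrel (ι ℂ 4 * ι ℂ 4) 1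
  | tx : Hrel (ι ℂ 4 * ι ℂ 0) (ι ℂ 0 * ι ℂ 4)
  | ty : Hrel (ι ℂ 4 * ι ℂ 1) (ι ℂ 1 * ι ℂ 4)
  | tu : Hrel (ι ℂ 4 * ι ℂ 2) (-(ι ℂ 2 * ι ℂ 4))
  | tv : Hrel (ι ℂ 4 * ι ℂ 3) (-(ι ℂ 3 * ι ℂ 4))

/-- The bosonization `H(gl(1,1))`, i.e. the free algebra modulo the two-sided
ideal generated by the relations. -/
abbrev Hgl : Type := RingQuot Hrel

/-- The image of the generator `x` in `H(gl(1,1))`. -/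
def hx : Hgl := RingQuot.mkAlgHom ℂ Hrel (ι ℂ 0)
/-- The image of the generator `y` in `H(gl(1,1))`. -/
def hy : Hgl := RingQuot.mkAlgHom ℂ Hrel (ι ℂ 1)
/-- The image of the generator `u` in `H(gl(1,1))`. -/
def hu : Hgl := RingQuot.mkAlgHom ℂ Hrel (ι ℂ 2)
/-- The image of the generator `v` in `H(gl(1,1))`. -/
def hv : Hgl := RingQuot.mkAlgHom ℂ Hrel (ι ℂ 3)
/-- The image of the generator `t` in `H(gl(1,1))`. -/
def ht : Hgl := RingQuot.mkAlgHom ℂ Hrel (ι ℂ 4)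

section SuperRelations

variable {A : Type*} [Ring A] {x y u v t : A}

lemma supercommutator_mul_comm_even (yu : y * u = u * y + u) (yv : y * v = v * y - v)
    (ty : t * y = y * t) : (u * v - v * u) * t * y = y * ((u * v - v * u) * t) := by
  have huv : y * (u * v) = u * v * y := by
    rw [← mul_assoc, yu, add_mul, mul_assoc, yv, mul_sub, sub_add_cancel, mul_assoc]
  have hvu : y * (v * u) = v * u * y := by
    rw [← mul_assoc, yv, sub_mul, mul_assoc, yu, mul_add, add_sub_cancel_right, mul_assoc]
  rw [mul_assoc, ty, ← mul_assoc, ← mul_assoc, sub_mul, mul_sub, huv, hvu]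

lemma supercommutator_mul_comm_left (uu : u * u = 0) (tu : t * u = -(u * t)) :
    (u * v - v * u) * t * u = u * ((u * v - v * u) * t) := by
  rw [mul_assoc, tu, mul_neg, ← mul_assoc, ← mul_assoc, ← neg_mul, sub_mul, mul_sub,
    mul_assoc v, uu, ← mul_assoc u u, uu, ← mul_assoc]
  simp

lemma supercommutator_mul_comm_right (vv : v * v = 0) (tv : t * v = -(v * t)) :
    (u * v - v * u) * t * v = v * ((u * v - v * u) * t) := by
  rw [mul_assoc, tv, mul_neg, ← mul_assoc, ← mul_assoc, ← neg_mul, sub_mul, mul_sub,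
    mul_assoc u, vv, ← mul_assoc v v, vv, ← mul_assoc]
  simp

lemma supercommutator_mul_comm_grading (tu : t * u = -(u * t)) (tv : t * v = -(v * t)) :
    (u * v - v * u) * t * t = t * ((u * v - v * u) * t) := by
  have huv : t * (u * v) = u * v * t := by
    rw [← mul_assoc, tu, neg_mul, mul_assoc, tv, mul_neg, neg_neg, mul_assoc]
  have hvu : t * (v * u) = v * u * t := by
    rw [← mul_assoc, tv, neg_mul, mul_assoc, tu, mul_neg, neg_neg, mul_assoc]
  rw [← mul_assoc, mul_sub, huv, hvu, sub_mul]

lemma supercommutator_mul_self (uu : u * u = 0) (vv : v * v = 0) (uv : u * v + v * u = x)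
    (tt : t * t = 1) (tu : t * u = -(u * t)) (tv : t * v = -(v * t)) :
    (u * v - v * u) * t * ((u * v - v * u) * t) = x * x := by
  have huvvu : u * v * (v * u) = 0 := by
    rw [mul_assoc, ← mul_assoc v, vv, zero_mul, mul_zero]
  have hvuuv : v * u * (u * v) = 0 := by
    rw [mul_assoc, ← mul_assoc u, uu, zero_mul, mul_zero]
  rw [mul_assoc, ← supercommutator_mul_comm_grading tu tv, mul_assoc _ t t, tt, mul_one, ← uv]
  simp only [sub_mul, mul_sub, add_mul, mul_add, huvvu, hvuuv]
  abel

lemma sub_mul_mul_add_eq_zero {w : A} (hw : ∀ r, w * r = r * w) (hx : ∀ r, x * r = r * x)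
    (h : w * w = x * x) (r : A) : (w - x) * r * (w + x) = 0 := by
  have hcomm : (w - x) * r = r * (w - x) := by
    rw [sub_mul, mul_sub, hw, hx]
  rw [hcomm, mul_assoc, sub_mul, mul_add, mul_add, h, hw x, add_comm, sub_self, mul_zero]

end SuperRelations

/-- An element of `H(gl(1,1))` commuting with the five generators is central. -/
lemma hgl_central_of_commute {w : Hgl} (h0 : w * hx = hx * w) (h1 : w * hy = hy * w)
    (h2 : w * hu = hu * w) (h3 : w * hv = hv * w) (h4 : w * ht = ht * w) (r : Hgl) :
    w * r = r * w := by
  obtain ⟨p, rfl⟩ := RingQuot.mkAlgHom_surjective ℂ Hrel r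
  induction p using FreeAlgebra.induction with
  | grade0 c => rw [AlgHom.commutes]; exact (Algebra.commutes c w).symm
  | grade1 i => fin_cases i <;> assumption
  | mul p q hp hq => rw [map_mul, ← mul_assoc, hp, mul_assoc, hq, mul_assoc]
  | add p q hp hq => rw [map_add, mul_add, add_mul, hp, hq]

/-- The images of the generators `x, y, u, v, t` in the two-dimensional representation of
`H(gl(1,1))` on which `x` acts as the identity and `t` as `diag(ε, -ε)`. -/
def repGen (ε : ℂ) : Fin 5 → Matrix (Fin 2) (Fin 2) ℂ :=
  ![1, !![1, 0; 0, 0], !![0, 1; 0, 0], !![0, 0; 1, 0], !![ε, 0; 0, -ε]]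

/-- The two-dimensional representation of `H(gl(1,1))` with generators acting by `repGen ε`. -/
def rep (ε : ℂ) (hε : ε * ε = 1) : Hgl →ₐ[ℂ] Matrix (Fin 2) (Fin 2) ℂ :=
  RingQuot.liftAlgHom ℂ ⟨FreeAlgebra.lift ℂ (repGen ε), fun a b h => by
    cases h <;> ext i j <;> fin_cases i <;> fin_cases j <;> simp [repGen, hε]⟩

lemma rep_mkAlgHom_ι (ε : ℂ) (hε : ε * ε = 1) (i : Fin 5) :
    rep ε hε (RingQuot.mkAlgHom ℂ Hrel (ι ℂ i)) = repGen ε i :=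
  (RingQuot.liftAlgHom_mkAlgHom_apply ℂ _ _ _).trans (FreeAlgebra.lift_ι_apply _ _)

/-- The central element `(uv - vu)t`, whose square is `x ^ 2`. -/
def hw : Hgl := (hu * hv - hv * hu) * ht

lemma rep_hw (ε : ℂ) (hε : ε * ε = 1) : rep ε hε hw = !![ε, 0; 0, ε] := by
  simp only [hw, hu, hv, ht, map_mul, map_sub, rep_mkAlgHom_ι]
  simp [repGen]

lemma rep_hx (ε : ℂ) (hε : ε * ε = 1) : rep ε hε hx = !![1, 0; 0, 1] := by
  rw [hx, rep_mkAlgHom_ι]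
  simp [repGen, Matrix.one_fin_two]

lemma hx_hu : hx * hu = hu * hx := by
  simpa [hx, hu] using RingQuot.mkAlgHom_rel ℂ Hrel.xu

lemma hx_hv : hx * hv = hv * hx := by
  simpa [hx, hv] using RingQuot.mkAlgHom_rel ℂ Hrel.xv

lemma hy_hu : hy * hu = hu * hy + hu := by
  have h := RingQuot.mkAlgHom_rel ℂ Hrel.yu
  simp only [map_mul, map_sub] at h
  exact sub_eq_iff_eq_add'.mp h

lemma hy_hv : hy * hv = hv * hy - hv := by
  have h := RingQuot.mkAlgHom_rel ℂ Hrel.yv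
  simp only [map_mul, map_sub, map_neg] at h
  exact (sub_eq_iff_eq_add'.mp h).trans (sub_eq_add_neg _ _).symm

lemma hu_hu : hu * hu = 0 := by
  simpa [hu] using RingQuot.mkAlgHom_rel ℂ Hrel.uu

lemma hv_hv : hv * hv = 0 := by
  simpa [hv] using RingQuot.mkAlgHom_rel ℂ Hrel.vv

lemma hu_hv_add : hu * hv + hv * hu = hx := by
  simpa [hu, hv, hx] using RingQuot.mkAlgHom_rel ℂ Hrel.uv

lemma ht_ht : ht * ht = 1 := by
  simpa [ht] using RingQuot.mkAlgHom_rel ℂ Hrel.tt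

lemma ht_hx : ht * hx = hx * ht := by
  simpa [ht, hx] using RingQuot.mkAlgHom_rel ℂ Hrel.tx

lemma ht_hy : ht * hy = hy * ht := by
  simpa [ht, hy] using RingQuot.mkAlgHom_rel ℂ Hrel.ty

lemma ht_hu : ht * hu = -(hu * ht) := by
  simpa [ht, hu] using RingQuot.mkAlgHom_rel ℂ Hrel.tu

lemma ht_hv : ht * hv = -(hv * ht) := by
  simpa [ht, hv] using RingQuot.mkAlgHom_rel ℂ Hrel.tv

lemma hw_hx : hw * hx = hx * hw := by
  have hu' : Commute hx hu := hx_hu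
  have hv' : Commute hx hv := hx_hv
  have ht' : Commute hx ht := ht_hx.symm
  exact (((hu'.mul_right hv').sub_right (hv'.mul_right hu')).mul_right ht').symm

lemma hw_hy : hw * hy = hy * hw :=
  supercommutator_mul_comm_even hy_hu hy_hv ht_hy

lemma hw_hu : hw * hu = hu * hw :=
  supercommutator_mul_comm_left hu_hu ht_hu

lemma hw_hv : hw * hv = hv * hw :=
  supercommutator_mul_comm_right hv_hv ht_hv

lemma hw_ht : hw * ht = ht * hw :=
  supercommutator_mul_comm_grading ht_hu ht_hv

lemma hw_central (r : Hgl) : hw * r = r * hw :=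
  hgl_central_of_commute hw_hx hw_hy hw_hu hw_hv hw_ht r

lemma hx_central (r : Hgl) : hx * r = r * hx :=
  hgl_central_of_commute rfl (by simpa [hx, hy] using RingQuot.mkAlgHom_rel ℂ Hrel.xy)
    hx_hu hx_hv ht_hx.symm r

lemma hw_mul_hw : hw * hw = hx * hx :=
  supercommutator_mul_self hu_hu hv_hv hu_hv_add ht_ht ht_hu ht_hv

/-- `H(gl(1,1))` is not a prime ring. -/
theorem stmt_2 :
    ¬ (∀ a b : Hgl, (∀ r : Hgl, a * r * b = 0) → a = 0 ∨ b = 0) := by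
  intro hprime
  rcases hprime (hw - hx) (hw + hx)
      (sub_mul_mul_add_eq_zero hw_central hx_central hw_mul_hw) with h | h
  · have h' := congrFun₂ (congrArg (rep (-1) (by norm_num)) h) 0 0
    rw [map_sub, rep_hw, rep_hx] at h'
    norm_num at h'
  · have h' := congrFun₂ (congrArg (rep 1 (by norm_num)) h) 0 0
    rw [map_add, rep_hw, rep_hx] at h'
    norm_num at h'
end
end

section
/- U(gl(1,1)) is a prime ring. -/
open FreeAlgebra

noncomputable section

/-- The defining relations of the enveloping algebra `U(gl(1,1))`: generators
`x = ι 0`, `y = ι 1`, `u = ι 2`, `v = ι 3`. -/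
inductive Urel : FreeAlgebra ℂ (Fin 4) → FreeAlgebra ℂ (Fin 4) → Prop
  | xy : Urel (ι ℂ 0 * ι ℂ 1) (ι ℂ 1 * ι ℂ 0)
  | xu : Urel (ι ℂ 0 * ι ℂ 2) (ι ℂ 2 * ι ℂ 0)
  | xv : Urel (ι ℂ 0 * ι ℂ 3) (ι ℂ 3 * ι ℂ 0)
  | yu : Urel (ι ℂ 1 * ι ℂ 2 - ι ℂ 2 * ι ℂ 1) (ι ℂ 2)
  | yv : Urel (ι ℂ 1 * ι ℂ 3 - ι ℂ 3 * ι ℂ 1) (-ι ℂ 3)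
  | uu : Urel (ι ℂ 2 * ι ℂ 2) 0
  | vv : Urel (ι ℂ 3 * ι ℂ 3) 0
  | uv : Urel (ι ℂ 2 * ι ℂ 3 + ι ℂ 3 * ι ℂ 2) (ι ℂ 0)

/-- The enveloping algebra `U(gl(1,1))`, i.e. the free algebra modulo the
two-sided ideal generated by the relations. -/
abbrev Ugl : Type := RingQuot Urel

/-- The image of the generator `x` in `U(gl(1,1))`. -/
def ux : Ugl := RingQuot.mkAlgHom ℂ Urel (ι ℂ 0)
/-- The image of the generator `y` in `U(gl(1,1))`. -/
def uy : Ugl := RingQuot.mkAlgHom ℂ Urel (ι ℂ 1)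
/-- The image of the generator `u` in `U(gl(1,1))`. -/
def uu : Ugl := RingQuot.mkAlgHom ℂ Urel (ι ℂ 2)
/-- The image of the generator `v` in `U(gl(1,1))`. -/
def uv : Ugl := RingQuot.mkAlgHom ℂ Urel (ι ℂ 3)

open Polynomial

theorem ux_comm (a : Ugl) : Commute ux a := by
  obtain ⟨a, rfl⟩ := RingQuot.mkAlgHom_surjective ℂ Urel a
  induction a using FreeAlgebra.induction with
  | grade0 c => rw [AlgHom.commutes]; exact (Algebra.commutes c ux).symm
  | grade1 i =>
    fin_cases i
    · exact Commute.refl _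
    · simpa [Commute, SemiconjBy, ux] using RingQuot.mkAlgHom_rel ℂ Urel.xy
    · simpa [Commute, SemiconjBy, ux] using RingQuot.mkAlgHom_rel ℂ Urel.xu
    · simpa [Commute, SemiconjBy, ux] using RingQuot.mkAlgHom_rel ℂ Urel.xv
  | mul a b ha hb => rw [map_mul]; exact ha.mul_right hb
  | add a b ha hb => rw [map_add]; exact ha.add_right hb

theorem uu_mul_uy : uu * uy = uy * uu - uu := by
  have h := RingQuot.mkAlgHom_rel ℂ Urel.yu
  simp only [map_sub, map_mul] at h
  change uy * uu - uu * uy = uu at h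
  rw [eq_sub_iff_add_eq', ← sub_eq_iff_eq_add.mp h]

theorem uv_mul_uy : uv * uy = uy * uv + uv := by
  have h := RingQuot.mkAlgHom_rel ℂ Urel.yv
  simp only [map_sub, map_mul, map_neg] at h
  change uy * uv - uv * uy = -uv at h
  rw [sub_eq_iff_eq_add.mp h]; abel

theorem uu_mul_uu : uu * uu = 0 := by
  simpa [uu] using RingQuot.mkAlgHom_rel ℂ Urel.uu

theorem uv_mul_uv : uv * uv = 0 := by
  simpa [uv] using RingQuot.mkAlgHom_rel ℂ Urel.vv

theorem uv_mul_uu : uv * uu = ux - uu * uv := by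
  have h := RingQuot.mkAlgHom_rel ℂ Urel.uv
  simp only [map_add, map_mul] at h
  change uu * uv + uv * uu = ux at h
  rw [← h]; abel

/-- Evaluation of `f ∈ ℂ[x][y]` at the commuting elements `ux`, `uy`. -/
def evalXY : ℂ[X][X] →+* Ugl :=
  eval₂RingHom' (aeval ux).toRingHom uy fun p => by
    induction p using Polynomial.induction_on' with
    | add p q hp hq => rw [map_add]; exact hp.add_left hq
    | monomial n c =>
      simp only [AlgHom.toRingHom_eq_coe, RingHom.coe_coe, aeval_monomial]
      exact Commute.mul_left (Algebra.commutes c uy) ((ux_comm uy).pow_left n)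

@[simp] theorem evalXY_X : evalXY X = uy := by simp [evalXY, eval₂RingHom']

@[simp] theorem evalXY_C_X : evalXY (C X) = ux := by simp [evalXY, eval₂RingHom']

@[simp] theorem evalXY_C_C (c : ℂ) : evalXY (C (C c)) = algebraMap ℂ Ugl c := by
  simp [evalXY, eval₂RingHom']

/-- The element `f₀ + f₁ u + f₂ v + f₃ u v`. -/
def normalForm (f₀ f₁ f₂ f₃ : ℂ[X][X]) : Ugl :=
  evalXY f₀ + evalXY f₁ * uu + evalXY f₂ * uv + evalXY f₃ * (uu * uv)

theorem normalForm_add (f₀ f₁ f₂ f₃ g₀ g₁ g₂ g₃ : ℂ[X][X]) :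
    normalForm f₀ f₁ f₂ f₃ + normalForm g₀ g₁ g₂ g₃ =
      normalForm (f₀ + g₀) (f₁ + g₁) (f₂ + g₂) (f₃ + g₃) := by
  simp only [normalForm, map_add]; noncomm_ring

theorem normalForm_mul_algebraMap (f₀ f₁ f₂ f₃ : ℂ[X][X]) (c : ℂ) :
    normalForm f₀ f₁ f₂ f₃ * algebraMap ℂ Ugl c =
      normalForm (C (C c) * f₀) (C (C c) * f₁) (C (C c) * f₂) (C (C c) * f₃) := by
  rw [← Algebra.commutes]
  simp only [normalForm, map_mul, evalXY_C_C]; noncomm_ring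

theorem normalForm_mul_ux (f₀ f₁ f₂ f₃ : ℂ[X][X]) :
    normalForm f₀ f₁ f₂ f₃ * ux =
      normalForm (C X * f₀) (C X * f₁) (C X * f₂) (C X * f₃) := by
  rw [← (ux_comm _).eq]
  simp only [normalForm, map_mul, evalXY_C_X]; noncomm_ring

theorem normalForm_mul_uy (f₀ f₁ f₂ f₃ : ℂ[X][X]) :
    normalForm f₀ f₁ f₂ f₃ * uy =
      normalForm (f₀ * X) (f₁ * (X - 1)) (f₂ * (X + 1)) (f₃ * X) := by
  have h : uu * uv * uy = uy * (uu * uv) := by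
    rw [mul_assoc, uv_mul_uy, mul_add, ← mul_assoc, uu_mul_uy, sub_mul, mul_assoc]; abel
  simp only [normalForm, add_mul, mul_assoc (evalXY _) _ uy, h, uu_mul_uy, uv_mul_uy, map_mul,
    map_sub, map_add, evalXY_X, mul_add, mul_sub, sub_mul, mul_assoc, mul_one]

theorem normalForm_mul_uu (f₀ f₁ f₂ f₃ : ℂ[X][X]) :
    normalForm f₀ f₁ f₂ f₃ * uu = normalForm (f₂ * C X) (f₀ + f₃ * C X) 0 (-f₂) := by
  have h : uu * uv * uu = ux * uu := by
    rw [mul_assoc, uv_mul_uu, mul_sub, ← mul_assoc uu uu, uu_mul_uu, zero_mul, sub_zero,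
      (ux_comm uu).eq]
  have hneg : evalXY (-f₂) * (uu * uv) = -(evalXY f₂ * (uu * uv)) := by
    rw [eq_neg_iff_add_eq_zero, ← add_mul, ← map_add, neg_add_cancel, map_zero, zero_mul]
  simp only [normalForm, hneg, add_mul, mul_assoc (evalXY _) _ uu, h, uu_mul_uu, uv_mul_uu, map_mul,
    map_add, map_zero, evalXY_C_X, mul_sub, zero_mul, mul_zero]
  abel

theorem normalForm_mul_uv (f₀ f₁ f₂ f₃ : ℂ[X][X]) :
    normalForm f₀ f₁ f₂ f₃ * uv = normalForm 0 0 f₀ f₁ := by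
  simp only [normalForm, add_mul, mul_assoc _ _ uv, uv_mul_uv, map_zero]
  noncomm_ring

theorem exists_normalForm (a : Ugl) : ∃ f₀ f₁ f₂ f₃, a = normalForm f₀ f₁ f₂ f₃ := by
  obtain ⟨a, rfl⟩ := RingQuot.mkAlgHom_surjective ℂ Urel a
  suffices h : ∀ f₀ f₁ f₂ f₃, ∃ g₀ g₁ g₂ g₃,
      normalForm f₀ f₁ f₂ f₃ * RingQuot.mkAlgHom ℂ Urel a = normalForm g₀ g₁ g₂ g₃ by
    simpa [normalForm] using h 1 0 0 0
  induction a using FreeAlgebra.induction with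
  | grade0 c =>
    intro f₀ f₁ f₂ f₃
    rw [AlgHom.commutes]
    exact ⟨_, _, _, _, normalForm_mul_algebraMap ..⟩
  | grade1 i =>
    intro f₀ f₁ f₂ f₃
    fin_cases i
    · exact ⟨_, _, _, _, normalForm_mul_ux ..⟩
    · exact ⟨_, _, _, _, normalForm_mul_uy ..⟩
    · exact ⟨_, _, _, _, normalForm_mul_uu ..⟩
    · exact ⟨_, _, _, _, normalForm_mul_uv ..⟩
  | mul a b ha hb =>
    intro f₀ f₁ f₂ f₃
    obtain ⟨g₀, g₁, g₂, g₃, hg⟩ := ha f₀ f₁ f₂ f₃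
    rw [map_mul, ← mul_assoc, hg]
    exact hb ..
  | add a b ha hb =>
    intro f₀ f₁ f₂ f₃
    obtain ⟨g₀, g₁, g₂, g₃, hg⟩ := ha f₀ f₁ f₂ f₃
    obtain ⟨k₀, k₁, k₂, k₃, hk⟩ := hb f₀ f₁ f₂ f₃
    rw [map_add, mul_add, hg, hk, normalForm_add]
    exact ⟨_, _, _, _, rfl⟩

/-- The images of the generators under `matrixRep`. -/
def matrixGen : Fin 4 → Matrix (Fin 2) (Fin 2) ℂ[X][X] :=
  ![!![C X, 0; 0, C X], !![X + 1, 0; 0, X], !![0, 1; 0, 0], !![0, 0; C X, 0]]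

/-- The generic two-dimensional representation of `U(gl(1,1))`. -/
def matrixRep : Ugl →ₐ[ℂ] Matrix (Fin 2) (Fin 2) ℂ[X][X] :=
  RingQuot.liftAlgHom ℂ ⟨FreeAlgebra.lift ℂ matrixGen, fun a b h => by
    cases h <;> ext i j : 1 <;> fin_cases i <;> fin_cases j <;>
      simp [matrixGen, Matrix.mul_apply, Fin.sum_univ_two] <;> ring⟩

theorem matrixRep_ι (i : Fin 4) :
    matrixRep (RingQuot.mkAlgHom ℂ Urel (ι ℂ i)) = matrixGen i := by
  simp [matrixRep]

theorem matrixRep_ux : matrixRep ux = !![C X, 0; 0, C X] := matrixRep_ι 0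

theorem matrixRep_uy : matrixRep uy = !![X + 1, 0; 0, X] := matrixRep_ι 1

theorem matrixRep_uu : matrixRep uu = !![0, 1; 0, 0] := matrixRep_ι 2

theorem matrixRep_uv : matrixRep uv = !![0, 0; C X, 0] := matrixRep_ι 3

theorem matrixRep_evalXY (f : ℂ[X][X]) :
    matrixRep (evalXY f) = Matrix.diagonal ![taylor 1 f, f] := by
  suffices h : (matrixRep : Ugl →+* _).comp evalXY =
      (Matrix.diagonalRingHom (Fin 2) ℂ[X][X]).comp
        (RingHom.pi ![(taylorAlgHom (1 : ℂ[X]) : ℂ[X][X] →+* ℂ[X][X]), RingHom.id _]) by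
    have := RingHom.congr_fun h f
    simp only [RingHom.comp_apply, RingHom.coe_coe] at this
    rw [this]
    ext i j : 1
    fin_cases i <;> fin_cases j <;> simp
  refine ringHom_ext' (ringHom_ext (fun c => ?_) ?_) ?_
  · ext i j : 1
    fin_cases i <;> fin_cases j <;> simp [Matrix.algebraMap_matrix_apply]
  · ext i j : 1
    fin_cases i <;> fin_cases j <;> simp [matrixRep_ux]
  · ext i j : 1
    fin_cases i <;> fin_cases j <;> simp [matrixRep_uy]

theorem matrixRep_normalForm (f₀ f₁ f₂ f₃ : ℂ[X][X]) :
    matrixRep (normalForm f₀ f₁ f₂ f₃) =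
      !![taylor 1 f₀ + taylor 1 f₃ * C X, taylor 1 f₁; f₂ * C X, f₀] := by
  simp only [normalForm, map_add, map_mul, matrixRep_evalXY, matrixRep_uu, matrixRep_uv]
  ext i j : 1
  fin_cases i <;> fin_cases j <;> simp [Matrix.mul_apply, Fin.sum_univ_two]

theorem matrixRep_injective : Function.Injective matrixRep := by
  rw [injective_iff_map_eq_zero]
  intro a ha
  obtain ⟨f₀, f₁, f₂, f₃, rfl⟩ := exists_normalForm a
  rw [matrixRep_normalForm] at ha
  have hX : (C X : ℂ[X][X]) ≠ 0 := by simp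
  have ht (f : ℂ[X][X]) (h : taylor 1 f = 0) : f = 0 :=
    taylor_injective (1 : ℂ[X]) (by simpa using h)
  have h₀ : f₀ = 0 := congr_fun₂ ha 1 1
  have h₁ : taylor 1 f₁ = 0 := congr_fun₂ ha 0 1
  have h₂ : f₂ * C X = 0 := congr_fun₂ ha 1 0
  have h₃ : taylor 1 f₀ + taylor 1 f₃ * C X = 0 := congr_fun₂ ha 0 0
  rw [h₀, map_zero, zero_add] at h₃
  rw [h₀, ht _ h₁, (mul_eq_zero.mp h₂).resolve_right hX,
    ht _ ((mul_eq_zero.mp h₃).resolve_right hX)]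
  simp [normalForm]

/-- `U(gl(1,1))` is a prime ring. -/
theorem stmt_17 :
    ∀ a b : Ugl, (∀ r : Ugl, a * r * b = 0) → a = 0 ∨ b = 0 := by
  intro a b h
  have hX : (C X : ℂ[X][X]) ≠ 0 := by simp
  have key (i j k l : Fin 2) : matrixRep a i j * matrixRep b k l = 0 := by
    have hr (r : Ugl) : (matrixRep a * matrixRep r * matrixRep b) i l = 0 := by
      rw [← map_mul, ← map_mul, h, map_zero]; rfl
    have huu := hr uu
    have huv := hr uv
    have huuv := hr (uu * uv)
    have hvu := hr (uv * uu)
    simp [matrixRep_uu, matrixRep_uv, Matrix.mul_apply, Fin.sum_univ_two] at huu huv huuv hvu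
    fin_cases j <;> fin_cases k <;> simp <;> tauto
  by_contra! hab
  obtain ⟨ha, hb⟩ := hab
  rw [← map_ne_zero_iff _ matrixRep_injective] at ha hb
  obtain ⟨i, j, hij⟩ : ∃ i j, matrixRep a i j ≠ 0 := by
    by_contra! hc
    exact ha (Matrix.ext hc)
  obtain ⟨k, l, hkl⟩ : ∃ k l, matrixRep b k l ≠ 0 := by
    by_contra! hc
    exact hb (Matrix.ext hc)
  exact mul_ne_zero hij hkl (key i j k l)
end
end
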